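/- Let M ≥ 4 be an integer, p the smallest prime with p > M, and let I_0, …, I_p ⊆ Z_{p(2M−1)} be the CRTm sequences. Then for all pairwise distinct i, j, k ∈ {0,1,…,p} and all τ_k, τ_j ∈ Z_{p(2M−1)}: if |I_i ∩ (I_k + τ_k)| = 2, then |(I_i \ (I_k + τ_k)) ∩ (I_j + τ_j)| ≤ 1. -/

import Mathlib

/-- The cyclic shift of a subset of `ZMod L` by `τ`. -/
def shiftF {L : ℕ} (S : Finset (ZMod L)) (τ : ZMod L) : Finset (ZMod L) :=
  S.image (· + τ)

/-- Hamming cross-correlation of `I₁` and `I₂` at relative shift `τ`. -/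
def Hcc {L : ℕ} (I₁ I₂ : Finset (ZMod L)) (τ : ZMod L) : ℕ :=
  (I₁ ∩ shiftF I₂ τ).card

/-- The set of nonzero differences of elements of `S`. -/
def dstar {L : ℕ} (S : Finset (ZMod L)) : Finset (ZMod L) :=
  ((S ×ˢ S).filter fun p => p.1 ≠ p.2).image fun p => p.1 - p.2

/-- `S` is equi-difference of weight `w` with generator `g`. -/
def EquiDiff {L : ℕ} (S : Finset (ZMod L)) (w : ℕ) (g : ZMod L) : Prop :=
  S = (Finset.range w).image (fun t : ℕ => (t : ZMod L) * g) ∧ S.card = w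

/-- The CRTm sequences: for `j < p`, `I_j = f⁻¹({(j·y, y) : 0 ≤ y ≤ M})`, and
`I_p = f⁻¹({(y, 0) : 0 ≤ y ≤ M})`, where `f` is the Chinese-remainder ring
isomorphism `ZMod (p(2M-1)) ≃+* ZMod p × ZMod (2M-1)`. -/
def CRTmSeq (M p : ℕ) (h : Nat.Coprime p (2 * M - 1)) (j : ℕ) :
    Finset (ZMod (p * (2 * M - 1))) :=
  if j = p then
    (Finset.range (M + 1)).image fun y : ℕ =>
      (ZMod.chineseRemainder h).symm ((y : ZMod p), (0 : ZMod (2 * M - 1)))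
  else
    (Finset.range (M + 1)).image fun y : ℕ =>
      (ZMod.chineseRemainder h).symm (((j * y : ℕ) : ZMod p), ((y : ℕ) : ZMod (2 * M - 1)))

theorem mem_shiftF {L : ℕ} {S : Finset (ZMod L)} {τ x : ZMod L} :
    x ∈ shiftF S τ ↔ x - τ ∈ S := by
  simp only [shiftF, Finset.mem_image]
  constructor
  · rintro ⟨a, ha, rfl⟩
    simpa using ha
  · intro hx
    exact ⟨x - τ, hx, by ring⟩

theorem mem_CRTmSeq_of_ne {M p : ℕ} {h : Nat.Coprime p (2 * M - 1)} {j : ℕ} (hj : j ≠ p)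
    {x : ZMod (p * (2 * M - 1))} :
    x ∈ CRTmSeq M p h j ↔ ∃ y ≤ M, ZMod.chineseRemainder h x = ((j : ZMod p) * y, (y : ZMod _)) := by
  simp [CRTmSeq, hj, RingEquiv.symm_apply_eq, eq_comm (b := ZMod.chineseRemainder h x)]

theorem mem_CRTmSeq_self {M p : ℕ} {h : Nat.Coprime p (2 * M - 1)}
    {x : ZMod (p * (2 * M - 1))} :
    x ∈ CRTmSeq M p h p ↔ ∃ y ≤ M, ZMod.chineseRemainder h x = ((y : ZMod p), 0) := by
  simp [CRTmSeq, RingEquiv.symm_apply_eq, eq_comm (b := ZMod.chineseRemainder h x)]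

theorem ZMod.natCast_injOn_of_lt {n a b : ℕ} (ha : a < n) (hb : b < n)
    (hab : (a : ZMod n) = b) : a = b :=
  Nat.ModEq.eq_of_lt_of_lt ((ZMod.natCast_eq_natCast_iff _ _ _).1 hab) ha hb

/-- The last CRTm sequence meets every shift of another one in at most one point. -/
theorem eq_of_mem_CRTmSeq_self {M p : ℕ} (hM : 4 ≤ M) {h : Nat.Coprime p (2 * M - 1)} {j : ℕ}
    (hj : j ≠ p) {σ τ x₁ x₂ : ZMod (p * (2 * M - 1))}
    (h₁ : x₁ - σ ∈ CRTmSeq M p h p) (h₂ : x₂ - σ ∈ CRTmSeq M p h p)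
    (k₁ : x₁ - τ ∈ CRTmSeq M p h j) (k₂ : x₂ - τ ∈ CRTmSeq M p h j) : x₁ = x₂ := by
  obtain ⟨y₁, -, e₁⟩ := mem_CRTmSeq_self.1 h₁
  obtain ⟨y₂, -, e₂⟩ := mem_CRTmSeq_self.1 h₂
  obtain ⟨z₁, hz₁, f₁⟩ := (mem_CRTmSeq_of_ne hj).1 k₁
  obtain ⟨z₂, hz₂, f₂⟩ := (mem_CRTmSeq_of_ne hj).1 k₂
  rw [map_sub] at e₁ e₂ f₁ f₂
  obtain ⟨-, e₁⟩ := Prod.ext_iff.1 e₁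
  obtain ⟨-, e₂⟩ := Prod.ext_iff.1 e₂
  have g₁ := (Prod.ext_iff.1 f₁).2
  have g₂ := (Prod.ext_iff.1 f₂).2
  simp only [Prod.snd_sub] at e₁ e₂ g₁ g₂
  have hz : z₁ = z₂ := ZMod.natCast_injOn_of_lt (n := 2 * M - 1) (by omega) (by omega)
    (by linear_combination e₁ - e₂ - g₁ + g₂)
  subst hz
  exact (ZMod.chineseRemainder h).injective (sub_left_injective (f₁.trans f₂.symm))

/-- Two points common to `I_i` and a shift of `I_j` lie at the ends of `I_i`. -/
theorem CRTmSeq_inter_positions {M p i j : ℕ} (hM : 4 ≤ M) (hp : p.Prime) (hpM : M < p)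
    {h : Nat.Coprime p (2 * M - 1)} (hi : i < p) (hj : j < p) (hij : i ≠ j)
    {τ x₁ x₂ : ZMod (p * (2 * M - 1))}
    (k₁ : x₁ - τ ∈ CRTmSeq M p h j) (k₂ : x₂ - τ ∈ CRTmSeq M p h j) {y₁ y₂ : ℕ}
    (hy : y₁ < y₂) (hy₂ : y₂ ≤ M)
    (e₁ : ZMod.chineseRemainder h x₁ = ((i : ZMod p) * y₁, (y₁ : ZMod _)))
    (e₂ : ZMod.chineseRemainder h x₂ = ((i : ZMod p) * y₂, (y₂ : ZMod _))) :
    (y₁ = 0 ∧ y₂ = M) ∨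
      ((y₁ = 1 ∧ y₂ = M ∨ y₁ = 0 ∧ y₂ + 1 = M) ∧ (i : ZMod p) * (M - 1) = -(j * M)) := by
  have : Fact p.Prime := ⟨hp⟩
  obtain ⟨z₁, hz₁, f₁⟩ := (mem_CRTmSeq_of_ne hj.ne).1 k₁
  obtain ⟨z₂, hz₂, f₂⟩ := (mem_CRTmSeq_of_ne hj.ne).1 k₂
  rw [map_sub, e₁] at f₁
  rw [map_sub, e₂] at f₂
  obtain ⟨a₁, b₁⟩ := Prod.ext_iff.1 f₁
  obtain ⟨a₂, b₂⟩ := Prod.ext_iff.1 f₂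
  simp only [Prod.snd_sub, Prod.fst_sub] at a₁ a₂ b₁ b₂
  have ha : (i : ZMod p) * (y₂ - y₁) = j * (z₂ - z₁) := by linear_combination a₂ - a₁
  have hb : (((y₂ - y₁ - (z₂ - z₁) : ℤ)) : ZMod (2 * M - 1)) = 0 := by
    push_cast
    linear_combination b₂ - b₁
  rw [ZMod.intCast_zmod_eq_zero_iff_dvd] at hb
  obtain ⟨c, hc⟩ := hb
  have hN : ((2 * M - 1 : ℕ) : ℤ) = 2 * M - 1 := by omega
  rw [hN] at hc
  have hc₁ : c < 2 := by by_contra! hcc; nlinarith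
  have hc₂ : -1 < c := by by_contra! hcc; nlinarith
  obtain rfl | rfl : c = 0 ∨ c = 1 := by omega
  · have hyz : (z₂ : ℤ) - z₁ = y₂ - y₁ := by linarith
    have hyz' : (z₂ : ZMod p) - z₁ = y₂ - y₁ := by exact_mod_cast congrArg (Int.cast : ℤ → ZMod p) hyz
    rw [hyz'] at ha
    rcases mul_eq_mul_right_iff.1 ha with he | he
    · exact absurd (ZMod.natCast_injOn_of_lt hi hj he) hij
    · have := ZMod.natCast_injOn_of_lt (by omega) (by omega) (sub_eq_zero.1 he)
      omega
  · rcases (by omega : y₁ = 0 ∧ y₂ = M ∨ y₂ + 1 = y₁ + M ∧ z₁ = z₂ + M) with hc' | ⟨hc', hz⟩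
    · exact Or.inl hc'
    · refine Or.inr ⟨by omega, ?_⟩
      have hc'' : (y₂ : ZMod p) + 1 = y₁ + M := by exact_mod_cast congrArg (Nat.cast : ℕ → ZMod p) hc'
      rw [hz] at ha
      push_cast at ha
      linear_combination ha - i * hc''

theorem exists_ordered_pair {M p : ℕ} {h : Nat.Coprime p (2 * M - 1)} {i : ℕ} (hi : i ≠ p)
    {T : Finset (ZMod (p * (2 * M - 1)))} (hT : T ⊆ CRTmSeq M p h i) (hcard : 1 < T.card) :
    ∃ x₁ ∈ T, ∃ x₂ ∈ T, ∃ y₁ y₂ : ℕ, y₁ < y₂ ∧ y₂ ≤ M ∧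
      ZMod.chineseRemainder h x₁ = ((i : ZMod p) * y₁, (y₁ : ZMod _)) ∧
      ZMod.chineseRemainder h x₂ = ((i : ZMod p) * y₂, (y₂ : ZMod _)) := by
  obtain ⟨x₁, h₁, x₂, h₂, hne⟩ := Finset.one_lt_card.1 hcard
  obtain ⟨y₁, l₁, e₁⟩ := (mem_CRTmSeq_of_ne hi).1 (hT h₁)
  obtain ⟨y₂, l₂, e₂⟩ := (mem_CRTmSeq_of_ne hi).1 (hT h₂)
  rcases lt_trichotomy y₁ y₂ with hy | rfl | hy
  · exact ⟨x₁, h₁, x₂, h₂, y₁, y₂, hy, l₂, e₁, e₂⟩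
  · exact absurd ((ZMod.chineseRemainder h).injective (e₁.trans e₂.symm)) hne
  · exact ⟨x₂, h₂, x₁, h₁, y₂, y₁, hy, l₁, e₂, e₁⟩

theorem CRTmSeq_inter_card_le_one {M p : ℕ} (hM : 4 ≤ M) {h : Nat.Coprime p (2 * M - 1)}
    {i j : ℕ} (hij : i ≠ j) (hp : i = p ∨ j = p) (τ : ZMod (p * (2 * M - 1))) :
    (CRTmSeq M p h i ∩ shiftF (CRTmSeq M p h j) τ).card ≤ 1 := by
  rw [Finset.card_le_one]
  intro a ha b hb
  rw [Finset.mem_inter, mem_shiftF] at ha hb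
  obtain ⟨a₁, a₂⟩ := ha
  obtain ⟨b₁, b₂⟩ := hb
  rw [← sub_zero a] at a₁
  rw [← sub_zero b] at b₁
  rcases hp with rfl | rfl
  · exact eq_of_mem_CRTmSeq_self hM hij.symm a₁ b₁ a₂ b₂
  · exact eq_of_mem_CRTmSeq_self hM hij a₂ b₂ a₁ b₁

theorem stmt12 (M p : ℕ) (hM : 4 ≤ M) (hp : p.Prime) (hpM : M < p)
    (hmin : ∀ q : ℕ, q.Prime → M < q → p ≤ q) (h : Nat.Coprime p (2 * M - 1)) :
    ∀ i ≤ p, ∀ j ≤ p, ∀ k ≤ p, i ≠ j → i ≠ k → j ≠ k →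
      ∀ τk τj : ZMod (p * (2 * M - 1)),
        (CRTmSeq M p h i ∩ shiftF (CRTmSeq M p h k) τk).card = 2 →
        ((CRTmSeq M p h i \ shiftF (CRTmSeq M p h k) τk) ∩
          shiftF (CRTmSeq M p h j) τj).card ≤ 1 := by
  intro i hi j hj k hk hij hik hjk τk τj hcard
  have : Fact p.Prime := ⟨hp⟩
  by_contra! hlt
  have hsub : (CRTmSeq M p h i \ shiftF (CRTmSeq M p h k) τk) ∩ shiftF (CRTmSeq M p h j) τj ⊆
      CRTmSeq M p h i ∩ shiftF (CRTmSeq M p h j) τj :=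
    Finset.inter_subset_inter_right Finset.sdiff_subset
  have hnk : ¬(i = p ∨ k = p) := fun hc => by
    have := CRTmSeq_inter_card_le_one (h := h) hM hik hc τk
    omega
  have hnj : ¬(i = p ∨ j = p) := fun hc => by
    have := CRTmSeq_inter_card_le_one (h := h) hM hij hc τj
    have := Finset.card_le_card hsub
    omega
  have hip : i < p := by omega
  have hjp : j < p := by omega
  have hkp : k < p := by omega
  obtain ⟨a, ha, b, hb, u, v, huv, hv, ea, eb⟩ :=
    exists_ordered_pair hip.ne (hsub.trans Finset.inter_subset_left) hlt
  obtain ⟨c, hc, d, hd, s, t, hst, ht, ec, ed⟩ :=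
    exists_ordered_pair hip.ne Finset.inter_subset_left (hcard ▸ one_lt_two)
  simp only [Finset.mem_inter, Finset.mem_sdiff, mem_shiftF] at ha hb hc hd
  have hus : u ≠ s := by
    rintro rfl
    obtain rfl := (ZMod.chineseRemainder h).injective (ea.trans ec.symm)
    exact ha.1.2 hc.2
  have hvt : v ≠ t := by
    rintro rfl
    obtain rfl := (ZMod.chineseRemainder h).injective (eb.trans ed.symm)
    exact hb.1.2 hd.2
  have hJ := CRTmSeq_inter_positions hM hp hpM hip hjp hij ha.2 hb.2 huv hv ea eb
  have hK := CRTmSeq_inter_positions hM hp hpM hip hkp hik hc.2 hd.2 hst ht ec ed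
  rcases hJ with hJ | ⟨hJ, hEj⟩
  · omega
  rcases hK with hK | ⟨hK, hEk⟩
  · omega
  rcases mul_eq_mul_right_iff.1 (neg_injective (hEj.symm.trans hEk)) with he | he
  · exact hjk (ZMod.natCast_injOn_of_lt hjp hkp he)
  · have : M = 0 := ZMod.natCast_injOn_of_lt hpM hp.pos (by simpa using he)
    omega
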